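/- arXiv:2208.01947 — 3 statements merged into one kernel-verified Lean document; each statement's English description precedes it below -/
import Mathlib

section
/- For real numbers E and ν with ν ≠ 1/2 and ν ≠ −1, the isotropic map 𝒞(A) = (E/(1+ν))·(A + (ν/(1−2ν))·tr(A)·I) on Sym is positive definite (i.e. A•𝒞(A) > 0 for all nonzero symmetric A) if and only if E > 0 and −1 < ν < 1/2. -/
open Matrix

/-- The Frobenius inner product `A • B = tr(Aᵀ B)` on 3×3 real matrices. -/
noncomputable def frob (A B : Matrix (Fin 3) (Fin 3) ℝ) : ℝ := (Aᵀ * B).trace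

/-- The isotropic tensor with Young's modulus `E` and Poisson's ratio `ν`:
`𝒞(A) = (E/(1+ν))·(A + (ν/(1−2ν))·tr(A)·I)`. -/
noncomputable def isoC (E ν : ℝ) (A : Matrix (Fin 3) (Fin 3) ℝ) :
    Matrix (Fin 3) (Fin 3) ℝ :=
  (E / (1 + ν)) • (A + (ν / (1 - 2 * ν)) • A.trace • (1 : Matrix (Fin 3) (Fin 3) ℝ))

theorem frob_isoC_self (E ν : ℝ) (A : Matrix (Fin 3) (Fin 3) ℝ) :
    frob A (isoC E ν A) = E / (1 + ν) * (frob A A + ν / (1 - 2 * ν) * A.trace ^ 2) := by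
  simp only [frob, isoC, Matrix.mul_smul, Matrix.mul_add, Matrix.mul_one, Matrix.trace_smul,
    Matrix.trace_add, Matrix.trace_transpose, smul_eq_mul]
  ring

theorem frob_self_pos {A : Matrix (Fin 3) (Fin 3) ℝ} (hA : A ≠ 0) : 0 < frob A A := by
  have h : frob A A = ∑ j, ∑ i, A i j ^ 2 := by
    simp [frob, Matrix.trace, Matrix.mul_apply, sq]
  rw [h]
  refine (Finset.sum_nonneg fun j _ => Finset.sum_nonneg fun i _ => sq_nonneg _).lt_of_ne' ?_
  contrapose! hA
  ext i j
  rw [Finset.sum_eq_zero_iff_of_nonneg fun j _ => Finset.sum_nonneg fun i _ => sq_nonneg _] at hA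
  have hj := hA j (Finset.mem_univ j)
  rw [Finset.sum_eq_zero_iff_of_nonneg fun i _ => sq_nonneg _] at hj
  exact pow_eq_zero_iff two_ne_zero |>.1 (hj i (Finset.mem_univ i))

theorem trace_sq_le_three_mul_frob_self (A : Matrix (Fin 3) (Fin 3) ℝ) :
    A.trace ^ 2 ≤ 3 * frob A A := by
  simp only [frob, Matrix.trace, Matrix.diag_apply, Matrix.mul_apply, Matrix.transpose_apply,
    Fin.sum_univ_three]
  nlinarith [sq_nonneg (A 0 0 - A 1 1), sq_nonneg (A 0 0 - A 2 2), sq_nonneg (A 1 1 - A 2 2),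
    sq_nonneg (A 0 1), sq_nonneg (A 0 2), sq_nonneg (A 1 0), sq_nonneg (A 1 2),
    sq_nonneg (A 2 0), sq_nonneg (A 2 1)]

/-- For `ν ≠ 1/2` and `ν ≠ −1`, the isotropic map `𝒞` is positive definite on `Sym`
iff `E > 0` and `−1 < ν < 1/2`. -/
theorem isoC_posDef_iff (E ν : ℝ) (hν₁ : ν ≠ 1 / 2) (hν₂ : ν ≠ -1) :
    (∀ A : Matrix (Fin 3) (Fin 3) ℝ, A.IsSymm → A ≠ 0 → 0 < frob A (isoC E ν A)) ↔
      (0 < E ∧ -1 < ν ∧ ν < 1 / 2) := by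
  constructor
  · intro h
    have hI := h 1 Matrix.isSymm_one one_ne_zero
    have hD := h (Matrix.diagonal ![1, -1, 0]) (Matrix.isSymm_diagonal _) fun h0 => by
      simpa using congrFun (congrFun h0 0) 0
    rw [frob_isoC_self] at hI hD
    have hν₃ : 1 - ν * 2 ≠ 0 := fun h0 => hν₁ (by linarith)
    have hν₄ : 1 + ν ≠ 0 := fun h0 => hν₂ (by linarith)
    have hI' : 0 < E / (1 - 2 * ν) := by
      have hI_eq : E / (1 + ν) * (frob 1 1 + ν / (1 - 2 * ν) *
          (1 : Matrix (Fin 3) (Fin 3) ℝ).trace ^ 2) = 3 * (E / (1 - 2 * ν)) := by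
        simp only [frob, Matrix.transpose_one, Matrix.mul_one, Matrix.trace_one, Fintype.card_fin]
        push_cast
        field_simp
        ring
      linarith
    have hD' : 0 < E / (1 + ν) := by
      simp [frob, Matrix.trace, Fin.sum_univ_three] at hD
      linarith
    rcases div_pos_iff.1 hI' with ⟨hE, h₁⟩ | ⟨hE, h₁⟩ <;>
    rcases div_pos_iff.1 hD' with ⟨hE', h₂⟩ | ⟨hE', h₂⟩
    · exact ⟨hE, by linarith, by linarith⟩
    all_goals linarith
  · rintro ⟨hE, h₁, h₂⟩ A - hA
    rw [frob_isoC_self]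
    have h₃ : 0 < 1 + ν := by linarith
    have h₄ : 0 < 1 - 2 * ν := by linarith
    refine mul_pos (div_pos hE h₃) ?_
    have hpos := frob_self_pos hA
    have htr := trace_sq_le_three_mul_frob_self A
    have key : 0 < (1 - 2 * ν) * frob A A + ν * A.trace ^ 2 := by
      rcases le_or_gt 0 ν with hν | hν
      · have := mul_pos h₄ hpos
        positivity
      · nlinarith [mul_pos h₃ hpos, mul_le_mul_of_nonpos_left htr hν.le]
    have h_eq : frob A A + ν / (1 - 2 * ν) * A.trace ^ 2 =
        ((1 - 2 * ν) * frob A A + ν * A.trace ^ 2) / (1 - 2 * ν) := by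
      rw [add_div, mul_div_cancel_left₀ _ h₄.ne', div_mul_eq_mul_div]
    rw [h_eq]
    exact div_pos key h₄
end

section
/- Let E > 0, −1 < ν < 1/2, and let 𝒞 be the isotropic map 𝒞(A) = (E/(1+ν))·(A + (ν/(1−2ν))·tr(A)·I). Let D ∈ Sym have ordered eigenvalues d₁ ≤ d₂ ≤ d₃ with corresponding orthonormal eigenvectors q₁, q₂, q₃, and set O₁₁ = q₁q₁ᵀ. If (1−ν)·d₁ + ν·(d₂+d₃) ≤ 0 and d₂ + ν·d₃ ≥ 0, then Y* = (d₁ + (ν/(1−ν))·(d₂+d₃))·O₁₁ is the unique minimizer over Sym⁻ of Y ↦ (D−Y)•𝒞(D−Y). -/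
open Matrix

/-- Membership in the cone `Sym⁻` of negative semidefinite symmetric matrices. -/
def negSD (Y : Matrix (Fin 3) (Fin 3) ℝ) : Prop := Y.IsSymm ∧ (-Y).PosSemidef

theorem frob_isoC_sub (E ν : ℝ) (S Z : Matrix (Fin 3) (Fin 3) ℝ) :
    frob (S - Z) (isoC E ν (S - Z)) =
      frob S (isoC E ν S) - 2 * frob (isoC E ν S) Z + frob Z (isoC E ν Z) := by
  simp only [frob_isoC_self]
  simp [frob, isoC, trace, Matrix.mul_apply, Fin.sum_univ_three]
  ring

theorem frob_isoC_self_pos {E ν : ℝ} (hE : 0 < E) (hν₁ : -1 < ν) (hν₂ : ν < 1 / 2)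
    {A : Matrix (Fin 3) (Fin 3) ℝ} (hA : A ≠ 0) : 0 < frob A (isoC E ν A) := by
  rw [frob_isoC_self]
  have h1 : 0 < 1 + ν := by linarith
  have h2 : 0 < 1 - 2 * ν := by linarith
  have h3 : 1 - ν * 2 ≠ 0 := by linarith
  have hk : 0 < 1 + 3 * (ν / (1 - 2 * ν)) := by
    have : 1 + 3 * (ν / (1 - 2 * ν)) = (1 + ν) / (1 - 2 * ν) := by
      field_simp
      ring
    rw [this]
    positivity
  have hp := frob_self_pos hA
  have ht := trace_sq_le_three_mul_frob_self A
  refine mul_pos (div_pos hE h1) ?_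
  generalize ν / (1 - 2 * ν) = k at hk
  rcases le_total 0 k with h | h
  · positivity
  · nlinarith [mul_pos hk hp, mul_nonneg (neg_nonneg.2 h) (sub_nonneg.2 ht)]

/-- Resolution of the identity for an orthonormal basis of `ℝ³`. -/
theorem sum_vecMulVec_eq_one {q₁ q₂ q₃ : Fin 3 → ℝ}
    (hn₁ : q₁ ⬝ᵥ q₁ = 1) (hn₂ : q₂ ⬝ᵥ q₂ = 1) (hn₃ : q₃ ⬝ᵥ q₃ = 1)
    (ho₁₂ : q₁ ⬝ᵥ q₂ = 0) (ho₁₃ : q₁ ⬝ᵥ q₃ = 0) (ho₂₃ : q₂ ⬝ᵥ q₃ = 0) :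
    vecMulVec q₁ q₁ + vecMulVec q₂ q₂ + vecMulVec q₃ q₃ = 1 := by
  have hQ : Matrix.of ![q₁, q₂, q₃] * (Matrix.of ![q₁, q₂, q₃])ᵀ = 1 := by
    ext i j
    change ![q₁, q₂, q₃] i ⬝ᵥ ![q₁, q₂, q₃] j = _
    fin_cases i <;> fin_cases j <;>
      simp [hn₁, hn₂, hn₃, ho₁₂, ho₁₃, ho₂₃, dotProduct_comm q₂ q₁, dotProduct_comm q₃ q₁,
        dotProduct_comm q₃ q₂]
  rw [← mul_eq_one_comm.1 hQ]
  ext i j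
  simp [Matrix.mul_apply, Fin.sum_univ_three, vecMulVec_apply]

theorem frob_vecMulVec_self (q : Fin 3 → ℝ) (A : Matrix (Fin 3) (Fin 3) ℝ) :
    frob (vecMulVec q q) A = q ⬝ᵥ A *ᵥ q := by
  simp [frob, trace, Matrix.mul_apply, mulVec, dotProduct, vecMulVec_apply, Fin.sum_univ_three]
  ring

theorem negSD.dotProduct_mulVec_nonpos {Y : Matrix (Fin 3) (Fin 3) ℝ} (hY : negSD Y)
    (q : Fin 3 → ℝ) : q ⬝ᵥ Y *ᵥ q ≤ 0 := by
  simpa [neg_mulVec] using hY.2.dotProduct_mulVec_nonneg q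

theorem negSD_smul_vecMulVec_self {y : ℝ} (hy : y ≤ 0) (q : Fin 3 → ℝ) :
    negSD (y • vecMulVec q q) := by
  refine ⟨by simp [IsSymm, transpose_vecMulVec], ?_⟩
  rw [← neg_smul]
  simpa using (posSemidef_vecMulVec_self_star q).smul (neg_nonneg.2 hy)

/-- Isotropic case: if `(1−ν)d₁ + ν(d₂+d₃) ≤ 0` and `d₂ + νd₃ ≥ 0`, then
`Y* = (d₁ + (ν/(1−ν))(d₂+d₃))·q₁q₁ᵀ` is the unique minimizer over `Sym⁻` of
`Y ↦ (D−Y)•𝒞(D−Y)`. -/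
theorem isoC_proj_rank_one_case (E ν : ℝ) (hE : 0 < E) (hν₁ : -1 < ν) (hν₂ : ν < 1 / 2)
    (D : Matrix (Fin 3) (Fin 3) ℝ) (hD : D.IsSymm)
    (d₁ d₂ d₃ : ℝ) (h12 : d₁ ≤ d₂) (h23 : d₂ ≤ d₃)
    (q₁ q₂ q₃ : Fin 3 → ℝ)
    (hq₁ : D *ᵥ q₁ = d₁ • q₁) (hq₂ : D *ᵥ q₂ = d₂ • q₂) (hq₃ : D *ᵥ q₃ = d₃ • q₃)
    (hn₁ : q₁ ⬝ᵥ q₁ = 1) (hn₂ : q₂ ⬝ᵥ q₂ = 1) (hn₃ : q₃ ⬝ᵥ q₃ = 1)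
    (ho₁₂ : q₁ ⬝ᵥ q₂ = 0) (ho₁₃ : q₁ ⬝ᵥ q₃ = 0) (ho₂₃ : q₂ ⬝ᵥ q₃ = 0)
    (hcase₁ : (1 - ν) * d₁ + ν * (d₂ + d₃) ≤ 0)
    (hcase₂ : 0 ≤ d₂ + ν * d₃) :
    (negSD ((d₁ + (ν / (1 - ν)) * (d₂ + d₃)) • vecMulVec q₁ q₁) ∧
      ∀ Y : Matrix (Fin 3) (Fin 3) ℝ, negSD Y →
        frob (D - (d₁ + (ν / (1 - ν)) * (d₂ + d₃)) • vecMulVec q₁ q₁)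
            (isoC E ν (D - (d₁ + (ν / (1 - ν)) * (d₂ + d₃)) • vecMulVec q₁ q₁)) ≤
          frob (D - Y) (isoC E ν (D - Y))) ∧
      ∀ Ystar : Matrix (Fin 3) (Fin 3) ℝ, negSD Ystar →
        (∀ Y : Matrix (Fin 3) (Fin 3) ℝ, negSD Y →
          frob (D - Ystar) (isoC E ν (D - Ystar)) ≤ frob (D - Y) (isoC E ν (D - Y))) →
        Ystar = (d₁ + (ν / (1 - ν)) * (d₂ + d₃)) • vecMulVec q₁ q₁ := by
  have hs : 0 < 1 - ν := by linarith
  have ht : 1 - ν * 2 ≠ 0 := by linarith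
  have hc : 0 < E / (1 + ν) := div_pos hE (by linarith)
  have hI := sum_vecMulVec_eq_one hn₁ hn₂ hn₃ ho₁₂ ho₁₃ ho₂₃
  have hDq : D = d₁ • vecMulVec q₁ q₁ + d₂ • vecMulVec q₂ q₂ + d₃ • vecMulVec q₃ q₃ := by
    conv_lhs => rw [← Matrix.mul_one D, ← hI]
    simp only [Matrix.mul_add, mul_vecMulVec, hq₁, hq₂, hq₃, smul_vecMulVec]
  set y := d₁ + (ν / (1 - ν)) * (d₂ + d₃) with hy
  have hy0 : y ≤ 0 := by
    have : y = ((1 - ν) * d₁ + ν * (d₂ + d₃)) / (1 - ν) := by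
      rw [hy]
      field_simp
    rw [this]
    exact div_nonpos_of_nonpos_of_nonneg hcase₁ hs.le
  have hN := negSD_smul_vecMulVec_self hy0 q₁
  set Z₀ := y • vecMulVec q₁ q₁ with hZ₀
  -- The stress at the candidate is positive semidefinite and annihilates the candidate.
  have htr : (D - Z₀).trace = (d₁ - y) + d₂ + d₃ := by
    rw [hZ₀, hDq]
    simp [trace_vecMulVec, hn₁, hn₂, hn₃]
    ring
  have hσ : isoC E ν (D - Z₀) =
      (E / (1 + ν)) • (((d₂ + ν * d₃) / (1 - ν)) • vecMulVec q₂ q₂ +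
        ((d₃ + ν * d₂) / (1 - ν)) • vecMulVec q₃ q₃) := by
    have hk : ν / (1 - 2 * ν) * ((d₁ - y) + d₂ + d₃) = ν / (1 - ν) * (d₂ + d₃) := by
      rw [hy]
      field_simp
      ring
    rw [isoC, htr, smul_smul, hk, ← hI, hZ₀, hDq, hy]
    congr 1
    have e₂ : (d₂ + ν * d₃) / (1 - ν) = d₂ + ν / (1 - ν) * (d₂ + d₃) := by
      field_simp
      ring
    have e₃ : (d₃ + ν * d₂) / (1 - ν) = d₃ + ν / (1 - ν) * (d₂ + d₃) := by
      field_simp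
      ring
    rw [e₂, e₃]
    module
  have hcase₃ : 0 ≤ d₃ + ν * d₂ := by nlinarith
  have hVI : ∀ Y, negSD Y → frob (isoC E ν (D - Z₀)) (Y - Z₀) ≤ 0 := by
    intro Y hY
    have h : frob (isoC E ν (D - Z₀)) (Y - Z₀) =
        (E / (1 + ν)) * ((d₂ + ν * d₃) / (1 - ν) * (q₂ ⬝ᵥ Y *ᵥ q₂) +
          (d₃ + ν * d₂) / (1 - ν) * (q₃ ⬝ᵥ Y *ᵥ q₃)) := by
      have lin : ∀ a b c : ℝ, ∀ P Q W : Matrix (Fin 3) (Fin 3) ℝ,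
          frob (c • (a • P + b • Q)) W = c * (a * frob P W + b * frob Q W) := by
        intro a b c P Q W
        simp [frob, Matrix.add_mul]
        ring
      rw [hσ, lin, frob_vecMulVec_self, frob_vecMulVec_self]
      simp [hZ₀, sub_mulVec, smul_mulVec, vecMulVec_mulVec, ho₁₂, ho₁₃]
    rw [h]
    refine mul_nonpos_of_nonneg_of_nonpos hc.le (add_nonpos ?_ ?_)
    · exact mul_nonpos_of_nonneg_of_nonpos (div_nonneg hcase₂ hs.le)
        (hY.dotProduct_mulVec_nonpos q₂)
    · exact mul_nonpos_of_nonneg_of_nonpos (div_nonneg hcase₃ hs.le)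
        (hY.dotProduct_mulVec_nonpos q₃)
  have hlt : ∀ Y, negSD Y → Y ≠ Z₀ →
      frob (D - Z₀) (isoC E ν (D - Z₀)) < frob (D - Y) (isoC E ν (D - Y)) := by
    intro Y hY hne
    have h := frob_isoC_sub E ν (D - Z₀) (Y - Z₀)
    rw [sub_sub_sub_cancel_right] at h
    linarith [hVI Y hY, frob_isoC_self_pos hE hν₁ hν₂ (sub_ne_zero.2 hne)]
  refine ⟨⟨hN, fun Y hY => ?_⟩, fun Y hY hmin => ?_⟩
  · rcases eq_or_ne Y Z₀ with rfl | hne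
    · exact le_rfl
    · exact (hlt Y hY hne).le
  · by_contra hne
    exact absurd (hmin Z₀ hN) (not_le.2 (hlt Y hY hne))
end

section
/- Let E > 0 and let 𝒞 = E·Id be E times the identity map on Sym. Then for every D ∈ Sym, the unique minimizer over Sym⁻ of Y ↦ (D−Y)•𝒞(D−Y) is Y* = (D − √(D²))/2, where √(D²) denotes the unique positive semidefinite symmetric matrix whose square is D². -/
open Matrix

namespace Matrix

variable {n : Type*} [Fintype n]

open scoped MatrixOrder in
lemma PosSemidef.trace_mul_nonneg {A B : Matrix n n ℝ} (hA : A.PosSemidef)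
    (hB : B.PosSemidef) : 0 ≤ (A * B).trace := by
  classical
  obtain ⟨C, rfl⟩ := CStarAlgebra.nonneg_iff_eq_star_mul_self.mp hA.nonneg
  rw [star_eq_conjTranspose, Matrix.mul_assoc, Matrix.trace_mul_comm]
  exact (hB.mul_mul_conjTranspose_same C).trace_nonneg

/-- If `R` is positive semidefinite, `D` is symmetric and `R² = D²`, then `D ≤ R` in the
Loewner order. -/
lemma PosSemidef.sub_of_mul_self_eq {D R : Matrix n n ℝ} (hD : D.IsSymm)
    (hR : R.PosSemidef) (h : R * R = D * D) : (R - D).PosSemidef := by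
  classical
  have hRT : Rᵀ = R := by simpa using hR.isHermitian.eq
  have hH : (R - D).IsHermitian := by
    simp [IsHermitian, conjTranspose_eq_transpose_of_trivial, hRT, hD.eq]
  rw [hH.posSemidef_iff_eigenvalues_nonneg]
  intro i
  set l := hH.eigenvalues i
  set v : n → ℝ := ⇑(hH.eigenvectorBasis i)
  have hv0 : v ≠ 0 := (WithLp.ofLp_eq_zero 2).ne.2 <|
    hH.eigenvectorBasis.orthonormal.ne_zero i
  have hev : (R - D) *ᵥ v = l • v := hH.mulVec_eigenvectorBasis i
  have hev' : v ᵥ* (R - D) = l • v := by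
    rw [← mulVec_transpose, transpose_sub, hRT, hD.eq, hev]
  have hz : (R - D) * (R + D) + (R + D) * (R - D) = 0 := by
    have : (R - D) * (R + D) + (R + D) * (R - D) = 2 • (R * R - D * D) := by noncomm_ring
    rw [this, h, sub_self, smul_zero]
  have hq : 2 * l * (v ⬝ᵥ ((R + D) *ᵥ v)) = 0 := by
    have h1 : v ⬝ᵥ (((R - D) * (R + D) + (R + D) * (R - D)) *ᵥ v) = 0 := by simp [hz]
    rw [add_mulVec, dotProduct_add, ← mulVec_mulVec, ← mulVec_mulVec, dotProduct_mulVec, hev,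
      hev', mulVec_smul, smul_dotProduct, dotProduct_smul, smul_eq_mul] at h1
    linarith
  have hvv : 0 < v ⬝ᵥ v := by simpa using dotProduct_star_self_pos_iff.mpr hv0
  have hnn : 0 ≤ v ⬝ᵥ (R *ᵥ v) := by simpa using hR.dotProduct_mulVec_nonneg v
  have hl : v ⬝ᵥ (R *ᵥ v) - v ⬝ᵥ (D *ᵥ v) = l * (v ⬝ᵥ v) := by
    rw [← dotProduct_sub, ← sub_mulVec, hev, dotProduct_smul, smul_eq_mul]
  rw [add_mulVec, dotProduct_add] at hq
  by_contra! hneg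
  replace hneg : l < 0 := hneg
  have : v ⬝ᵥ (R *ᵥ v) + v ⬝ᵥ (D *ᵥ v) = 0 := by
    simpa [hneg.ne] using hq
  nlinarith [mul_neg_of_neg_of_pos hneg hvv]

end Matrix

/-- Projection inequality: the candidate beats any competitor `Y` by at least
`E` times the squared distance from it to `Y`. -/
lemma frob_proj_add_le {E : ℝ} (hE : 0 < E) {D R Y : Matrix (Fin 3) (Fin 3) ℝ}
    (hD : D.IsSymm) (hR : R.PosSemidef) (hRsq : R * R = D * D) (hY : negSD Y) :
    frob (D - (1 / 2 : ℝ) • (D - R)) (E • (D - (1 / 2 : ℝ) • (D - R))) +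
      E * frob (Y - (1 / 2 : ℝ) • (D - R)) (Y - (1 / 2 : ℝ) • (D - R)) ≤
      frob (D - Y) (E • (D - Y)) := by
  have hRT : Rᵀ = R := by simpa using hR.isHermitian.eq
  have hP : (R + D).PosSemidef := by
    simpa using PosSemidef.sub_of_mul_self_eq (D := -D) hD.neg hR (by simpa using hRsq)
  have h1 := hP.trace_mul_nonneg hY.2
  have h2 : (R * R).trace = (D * D).trace := by rw [hRsq]
  have h3 := Matrix.trace_mul_comm R D
  have h4 := Matrix.trace_mul_comm R Y
  have h5 := Matrix.trace_mul_comm D Y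
  have key : frob (D - (1 / 2 : ℝ) • (D - R)) (D - (1 / 2 : ℝ) • (D - R)) +
      frob (Y - (1 / 2 : ℝ) • (D - R)) (Y - (1 / 2 : ℝ) • (D - R)) ≤ frob (D - Y) (D - Y) := by
    simp only [frob, transpose_sub, transpose_smul, hRT, hD.eq, hY.1.eq, Matrix.mul_sub,
      Matrix.sub_mul, Matrix.add_mul, Matrix.mul_neg, Matrix.smul_mul, Matrix.mul_smul, smul_sub,
      trace_sub, trace_add, trace_neg, trace_smul, smul_eq_mul] at h1 ⊢
    linarith
  have hs (A : Matrix (Fin 3) (Fin 3) ℝ) : frob A (E • A) = E * frob A A := by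
    simp [frob]
  rw [hs, hs, ← mul_add]
  exact mul_le_mul_of_nonneg_left key hE.le

lemma frob_self_nonneg (A : Matrix (Fin 3) (Fin 3) ℝ) : 0 ≤ frob A A := by
  simpa [frob] using (posSemidef_conjTranspose_mul_self A).trace_nonneg

lemma frob_self_eq_zero {A : Matrix (Fin 3) (Fin 3) ℝ} (h : frob A A = 0) : A = 0 :=
  trace_conjTranspose_mul_self_eq_zero_iff.mp (by simpa [frob] using h)

/-- For `𝒞 = E·Id` with `E > 0`, the unique minimizer over `Sym⁻` of
`Y ↦ (D−Y)•𝒞(D−Y)` is `Y* = (D − √(D²))/2`, where `√(D²)` is the unique positive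
semidefinite (symmetric) matrix whose square is `D²`. -/
theorem proj_for_scaled_identity (E : ℝ) (hE : 0 < E)
    (D : Matrix (Fin 3) (Fin 3) ℝ) (hD : D.IsSymm)
    (R : Matrix (Fin 3) (Fin 3) ℝ) (hR : R.PosSemidef) (hRsq : R * R = D * D) :
    (negSD ((1 / 2 : ℝ) • (D - R)) ∧
      ∀ Y : Matrix (Fin 3) (Fin 3) ℝ, negSD Y →
        frob (D - (1 / 2 : ℝ) • (D - R)) (E • (D - (1 / 2 : ℝ) • (D - R))) ≤
          frob (D - Y) (E • (D - Y))) ∧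
      ∀ Ystar : Matrix (Fin 3) (Fin 3) ℝ, negSD Ystar →
        (∀ Y : Matrix (Fin 3) (Fin 3) ℝ, negSD Y →
          frob (D - Ystar) (E • (D - Ystar)) ≤ frob (D - Y) (E • (D - Y))) →
        Ystar = (1 / 2 : ℝ) • (D - R) := by
  have hneg : negSD ((1 / 2 : ℝ) • (D - R)) := by
    have hN := PosSemidef.sub_of_mul_self_eq hD hR hRsq
    have hRT : Rᵀ = R := by simpa using hR.isHermitian.eq
    refine ⟨by simp [IsSymm, hRT, hD.eq], ?_⟩
    rw [← smul_neg, neg_sub]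
    exact hN.smul (by norm_num)
  refine ⟨⟨hneg, fun Y hY => ?_⟩, fun Ystar hYs hmin => ?_⟩
  · have h1 := frob_proj_add_le hE hD hR hRsq hY
    have h2 := mul_nonneg hE.le (frob_self_nonneg (Y - (1 / 2 : ℝ) • (D - R)))
    linarith
  · have h1 := frob_proj_add_le hE hD hR hRsq hYs
    have h2 := hmin _ hneg
    have h3 := frob_self_nonneg (Ystar - (1 / 2 : ℝ) • (D - R))
    refine sub_eq_zero.mp (frob_self_eq_zero (le_antisymm ?_ h3))
    exact nonpos_of_mul_nonpos_right (by linarith) hE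
end
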